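/- Let V : ℝ → ℝ be real analytic on all of ℝ and satisfy the growth condition lim_{x→±∞} V(x)/(|x|+1) = +∞. Then there exists a unique Borel probability measure μ_V on ℝ with compact support such that I_V(μ_V) ≤ I_V(ν) for every Borel probability measure ν on ℝ; moreover, every Borel probability measure ν on ℝ with I_V(ν) ≤ I_V(μ) for all Borel probability measures μ is equal to μ_V. -/

import Mathlib

open MeasureTheory Filter Set
open scoped ENNReal

/-- The energy kernel `k_V(t,s) = ½log|t−s|⁻¹ + ½log|eᵗ−eˢ|⁻¹ + ½V(t) + ½V(s)`,
as a real number off the diagonal (on the diagonal the kernel is `+∞`). -/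
noncomputable def kernelV (V : ℝ → ℝ) (t s : ℝ) : ℝ :=
  1/2 * (-Real.log |t - s|) + 1/2 * (-Real.log |Real.exp t - Real.exp s|)
    + 1/2 * V t + 1/2 * V s

/-- The positive part of the energy kernel, valued in `ℝ≥0∞`; it is `⊤` on the diagonal. -/
noncomputable def kernelVPos (V : ℝ → ℝ) (p : ℝ × ℝ) : ℝ≥0∞ :=
  if p.1 = p.2 then ⊤ else ENNReal.ofReal (kernelV V p.1 p.2)

/-- The negative part of the energy kernel, valued in `ℝ≥0∞`; it vanishes on the diagonal. -/
noncomputable def kernelVNeg (V : ℝ → ℝ) (p : ℝ × ℝ) : ℝ≥0∞ :=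
  if p.1 = p.2 then 0 else ENNReal.ofReal (-(kernelV V p.1 p.2))

/-- The energy functional `I_V(μ) = ∬ k_V(t,s) dμ(t)dμ(s)`, with values in `EReal`
(when the kernel is bounded below and `μ` is a probability measure, the negative part is
finite, so the value lies in `(−∞, +∞]`). -/
noncomputable def energyV (V : ℝ → ℝ) (μ : Measure ℝ) : EReal :=
  ((∫⁻ p : ℝ × ℝ, kernelVPos V p ∂(μ.prod μ)) : EReal)
    - ((∫⁻ p : ℝ × ℝ, kernelVNeg V p ∂(μ.prod μ)) : EReal)

open scoped Topology

/-- The energy kernel shifted by a constant `C`, with value `⊤` on the diagonal. -/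
noncomputable def shiftedKernel (V : ℝ → ℝ) (C : ℝ) (p : ℝ × ℝ) : ℝ≥0∞ :=
  if p.1 = p.2 then ⊤ else ENNReal.ofReal (kernelV V p.1 p.2 + C)

/-- The energy with respect to the shifted kernel. -/
noncomputable def shiftedEnergy (V : ℝ → ℝ) (C : ℝ) (μ : Measure ℝ) : ℝ≥0∞ :=
  ∫⁻ p, shiftedKernel V C p ∂(μ.prod μ)

lemma exists_linear_lower_bound {V : ℝ → ℝ} (hV : Continuous V)
    (htop : Tendsto (fun x => V x / (|x| + 1)) atTop atTop)
    (hbot : Tendsto (fun x => V x / (|x| + 1)) atBot atTop) (A : ℝ) :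
    ∃ B : ℝ, 0 ≤ B ∧ ∀ x, A * |x| - B ≤ V x := by
  have key : ∀ᶠ x in cocompact ℝ, A * |x| - |A| ≤ V x := by
    rw [cocompact_eq_atBot_atTop, eventually_sup]
    have h : ∀ x : ℝ, A ≤ V x / (|x| + 1) → A * |x| - |A| ≤ V x := by
      intro x hx
      rw [le_div_iff₀ (by positivity)] at hx
      linarith [neg_abs_le A]
    exact ⟨(hbot.eventually_ge_atTop A).mono h, (htop.eventually_ge_atTop A).mono h⟩
  obtain ⟨K, hK, hKV⟩ := mem_cocompact.1 key
  obtain ⟨c, hc⟩ := (hK.image (f := fun x => A * |x| - V x) (by fun_prop)).bddAbove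
  refine ⟨max |A| c, le_max_of_le_left (abs_nonneg A), fun x => ?_⟩
  by_cases hx : x ∈ K
  · have := hc (mem_image_of_mem _ hx)
    linarith [le_max_right |A| c]
  · have : A * |x| - |A| ≤ V x := hKV hx
    linarith [le_max_left |A| c]

lemma log_abs_sub_le (t s : ℝ) : Real.log |t - s| ≤ |t| + |s| :=
  (Real.log_le_self (abs_nonneg _)).trans (abs_sub t s)

lemma log_abs_exp_sub_exp_le (t s : ℝ) : Real.log |Real.exp t - Real.exp s| ≤ |t| + |s| := by
  rcases eq_or_ne t s with rfl | hts
  · simp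
  · rw [Real.log_le_iff_le_exp (abs_pos.2 (sub_ne_zero.2 (Real.exp_injective.ne hts)))]
    have h1 : Real.exp t ≤ Real.exp (|t| + |s|) :=
      Real.exp_le_exp.2 (by linarith [le_abs_self t, abs_nonneg s])
    have h2 : Real.exp s ≤ Real.exp (|t| + |s|) :=
      Real.exp_le_exp.2 (by linarith [le_abs_self s, abs_nonneg t])
    rw [abs_le]
    constructor <;> linarith [Real.exp_pos t, Real.exp_pos s]

lemma kernelV_lower_bound {V : ℝ → ℝ} {B : ℝ} (hB : ∀ x, 4 * |x| - B ≤ V x) (t s : ℝ) :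
    |t| + |s| - B ≤ kernelV V t s := by
  unfold kernelV
  linarith [log_abs_sub_le t s, log_abs_exp_sub_exp_le t s, hB t, hB s]

lemma measurable_kernelV {V : ℝ → ℝ} (hV : Measurable V) :
    Measurable fun p : ℝ × ℝ => kernelV V p.1 p.2 := by
  unfold kernelV
  fun_prop

lemma measurable_shiftedKernel {V : ℝ → ℝ} (hV : Measurable V) (C : ℝ) :
    Measurable (shiftedKernel V C) :=
  Measurable.ite measurableSet_diagonal measurable_const
    ((measurable_kernelV hV).add_const C).ennreal_ofReal

lemma shiftedKernel_symm (V : ℝ → ℝ) (C t s : ℝ) :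
    shiftedKernel V C (t, s) = shiftedKernel V C (s, t) := by
  simp only [shiftedKernel, kernelV, abs_sub_comm s t, abs_sub_comm (Real.exp s), eq_comm (a := s)]
  split_ifs
  · rfl
  · congr 1; ring

lemma shiftedEnergy_add {V : ℝ → ℝ} {B D : ℝ} (hB : ∀ t s, 0 ≤ kernelV V t s + B) (hD : 0 ≤ D)
    (μ : Measure ℝ) [IsProbabilityMeasure μ] :
    shiftedEnergy V (B + D) μ = shiftedEnergy V B μ + ENNReal.ofReal D := by
  have h : ∀ p, shiftedKernel V (B + D) p = shiftedKernel V B p + ENNReal.ofReal D := by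
    intro p
    unfold shiftedKernel
    split_ifs
    · simp
    · rw [← ENNReal.ofReal_add (hB _ _) hD, add_assoc]
  simp [shiftedEnergy, h, lintegral_add_right]

lemma energyV_eq {V : ℝ → ℝ} (hV : Measurable V) {C : ℝ} (hC : 0 ≤ C)
    (hb : ∀ t s, 0 ≤ kernelV V t s + C) (μ : Measure ℝ) [IsProbabilityMeasure μ] :
    energyV V μ = (shiftedEnergy V C μ : EReal) - (C : EReal) := by
  have hneg : Measurable (kernelVNeg V) :=
    Measurable.ite measurableSet_diagonal measurable_const (measurable_kernelV hV).neg.ennreal_ofReal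
  have hpt : ∀ p, kernelVPos V p + ENNReal.ofReal C = shiftedKernel V C p + kernelVNeg V p := by
    intro p
    unfold kernelVPos kernelVNeg shiftedKernel
    split_ifs
    · simp
    · have := hb p.1 p.2
      rcases le_total 0 (kernelV V p.1 p.2) with h | h
      · rw [ENNReal.ofReal_of_nonpos (neg_nonpos.2 h), add_zero, ENNReal.ofReal_add h hC]
      · rw [ENNReal.ofReal_of_nonpos h, zero_add, ← ENNReal.ofReal_add this (neg_nonneg.2 h)]
        congr 1; ring
  have hint : (∫⁻ p, kernelVPos V p ∂(μ.prod μ)) + ENNReal.ofReal C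
      = shiftedEnergy V C μ + ∫⁻ p, kernelVNeg V p ∂(μ.prod μ) := by
    rw [shiftedEnergy, ← lintegral_add_right _ hneg, ← lintegral_congr hpt,
      lintegral_add_right _ measurable_const]
    simp
  have hfin : ∫⁻ p, kernelVNeg V p ∂(μ.prod μ) ≠ ⊤ := by
    refine ne_top_of_le_ne_top ENNReal.ofReal_ne_top (b := ENNReal.ofReal C) ?_
    calc ∫⁻ p, kernelVNeg V p ∂(μ.prod μ) ≤ ∫⁻ _, ENNReal.ofReal C ∂(μ.prod μ) := by
          refine lintegral_mono fun p => ?_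
          unfold kernelVNeg
          split_ifs
          · simp
          · exact ENNReal.ofReal_le_ofReal (by linarith [hb p.1 p.2])
      _ = ENNReal.ofReal C := by simp
  unfold energyV
  generalize (∫⁻ p, kernelVPos V p ∂(μ.prod μ)) = P at *
  generalize (∫⁻ p, kernelVNeg V p ∂(μ.prod μ)) = N at *
  generalize shiftedEnergy V C μ = T at *
  lift N to NNReal using hfin
  induction P with
  | top =>
    have : T = ⊤ := by
      by_contra hT
      lift T to NNReal using hT
      simp at hint
      exact absurd hint (by exact_mod_cast ENNReal.coe_ne_top.symm)
    subst this
    simp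
  | coe P =>
    have hT : T ≠ ⊤ := by
      rintro rfl
      simp at hint
    lift T to NNReal using hT
    have := congrArg ENNReal.toReal hint
    rw [ENNReal.toReal_add (by simp) (by simp), ENNReal.toReal_add (by simp) (by simp),
      ENNReal.toReal_ofReal hC] at this
    simp only [ENNReal.coe_toReal] at this
    have h2 : (P : ℝ) - N = T - C := by linarith
    simp only [EReal.coe_nnreal_eq_coe_real]
    exact_mod_cast congrArg ((↑) : ℝ → EReal) h2

lemma energyV_le_iff {V : ℝ → ℝ} (hV : Measurable V) {C : ℝ} (hC : 0 ≤ C)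
    (hb : ∀ t s, 0 ≤ kernelV V t s + C) (μ ν : Measure ℝ) [IsProbabilityMeasure μ]
    [IsProbabilityMeasure ν] :
    energyV V μ ≤ energyV V ν ↔ shiftedEnergy V C μ ≤ shiftedEnergy V C ν := by
  rw [energyV_eq hV hC hb, energyV_eq hV hC hb]
  constructor
  · intro h
    have h' := add_le_add_left h (C : EReal)
    rw [EReal.sub_add_cancel, EReal.sub_add_cancel] at h'
    exact_mod_cast h'
  · intro h
    exact EReal.sub_le_sub (by exact_mod_cast h) le_rfl

/-- Continuous bounded truncations increasing to the shifted kernel. -/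
noncomputable def truncatedKernel (V : ℝ → ℝ) (C : ℝ) (n : ℕ) (p : ℝ × ℝ) : NNReal :=
  min (Real.toNNReal (1/2 * (-Real.log (max |p.1 - p.2| (1 / (n + 1))))
    + 1/2 * (-Real.log (max |Real.exp p.1 - Real.exp p.2| (1 / (n + 1))))
    + 1/2 * V p.1 + 1/2 * V p.2 + C)) n

lemma continuous_truncatedKernel {V : ℝ → ℝ} (hV : Continuous V) (C : ℝ) (n : ℕ) :
    Continuous (truncatedKernel V C n) := by
  unfold truncatedKernel
  have h : ∀ x : ℝ, max x (1 / ((n : ℝ) + 1)) ≠ 0 := fun x =>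
    (lt_max_of_lt_right (by positivity)).ne'
  have h1 : Continuous fun p : ℝ × ℝ => Real.log (max |p.1 - p.2| (1 / ((n : ℝ) + 1))) :=
    Continuous.log (by fun_prop) fun _ => h _
  have h2 : Continuous fun p : ℝ × ℝ =>
      Real.log (max |Real.exp p.1 - Real.exp p.2| (1 / ((n : ℝ) + 1))) :=
    Continuous.log (by fun_prop) fun _ => h _
  exact (continuous_real_toNNReal.comp (by fun_prop)).min continuous_const

lemma monotone_truncatedKernel (V : ℝ → ℝ) (C : ℝ) : Monotone (truncatedKernel V C) := by
  intro m n hmn p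
  have hd : 1 / ((n : ℝ) + 1) ≤ 1 / ((m : ℝ) + 1) :=
    one_div_le_one_div_of_le (by positivity) (by exact_mod_cast Nat.succ_le_succ hmn)
  have hlog : ∀ x : ℝ, Real.log (max x (1 / ((n : ℝ) + 1)))
      ≤ Real.log (max x (1 / ((m : ℝ) + 1))) := fun x =>
    Real.log_le_log (lt_max_of_lt_right (by positivity)) (max_le_max_left x hd)
  refine min_le_min (Real.toNNReal_le_toNNReal ?_) (by exact_mod_cast hmn)
  linarith [hlog |p.1 - p.2|, hlog |Real.exp p.1 - Real.exp p.2|]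

lemma iSup_truncatedKernel (V : ℝ → ℝ) (C : ℝ) (p : ℝ × ℝ) :
    ⨆ n, (truncatedKernel V C n p : ℝ≥0∞) = shiftedKernel V C p := by
  have hmono : Monotone fun n => (truncatedKernel V C n p : ℝ≥0∞) := fun m n h =>
    ENNReal.coe_le_coe.2 (monotone_truncatedKernel V C h p)
  refine tendsto_nhds_unique (tendsto_atTop_iSup hmono) ?_
  have hN : Tendsto (fun n : ℕ => 1 / ((n : ℝ) + 1)) atTop (𝓝 0) :=
    tendsto_one_div_add_atTop_nhds_zero_nat
  unfold shiftedKernel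
  split_ifs with h
  · obtain ⟨t, s⟩ := p
    obtain rfl : t = s := h
    have hlog : Tendsto (fun n : ℕ => -Real.log (1 / ((n : ℝ) + 1))) atTop atTop := by
      refine tendsto_neg_atBot_atTop.comp (Real.tendsto_log_nhdsNE_zero.comp ?_)
      exact tendsto_nhdsWithin_iff.2 ⟨hN, .of_forall fun n => by simp; positivity⟩
    have hreal : Tendsto (fun n : ℕ => 1/2 * (-Real.log (1 / ((n : ℝ) + 1)))
        + 1/2 * (-Real.log (1 / ((n : ℝ) + 1))) + 1/2 * V t + 1/2 * V t + C) atTop atTop := by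
      refine tendsto_atTop_add_const_right _ _ (tendsto_atTop_add_const_right _ _
        (tendsto_atTop_add_const_right _ _ ?_))
      refine hlog.congr fun n => ?_
      ring
    have hmax : ∀ n : ℕ, max |(0 : ℝ)| (1 / ((n : ℝ) + 1)) = 1 / ((n : ℝ) + 1) := fun n =>
      max_eq_right (by rw [abs_zero]; positivity)
    rw [ENNReal.tendsto_nhds_top_iff_nnreal]
    intro x
    have h1 := (tendsto_real_toNNReal_atTop.comp hreal).eventually_gt_atTop x
    have h2 := (tendsto_natCast_atTop_atTop (R := NNReal)).eventually_gt_atTop x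
    filter_upwards [h1, h2] with n h1 h2
    rw [ENNReal.coe_lt_coe]
    simp only [truncatedKernel, sub_self, hmax]
    exact lt_min h1 h2
  · have h1 : 0 < |p.1 - p.2| := abs_pos.2 (sub_ne_zero.2 h)
    have h2 : 0 < |Real.exp p.1 - Real.exp p.2| :=
      abs_pos.2 (sub_ne_zero.2 (Real.exp_injective.ne h))
    refine tendsto_const_nhds.congr' ?_
    filter_upwards [hN.eventually_le_const h1, hN.eventually_le_const h2,
      (tendsto_natCast_atTop_atTop (R := NNReal)).eventually_ge_atTop
        (kernelV V p.1 p.2 + C).toNNReal] with n h1 h2 h3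
    simp only [truncatedKernel, max_eq_left h1, max_eq_left h2]
    rw [ENNReal.ofReal]
    congr 1
    exact (min_eq_left h3).symm

lemma lowerSemicontinuous_shiftedEnergy {V : ℝ → ℝ} (hV : Continuous V) (C : ℝ) :
    LowerSemicontinuous fun μ : ProbabilityMeasure ℝ => shiftedEnergy V C μ := by
  have h : (fun μ : ProbabilityMeasure ℝ => shiftedEnergy V C μ) = fun μ : ProbabilityMeasure ℝ =>
      ⨆ n, ∫⁻ p, truncatedKernel V C n p ∂((μ : Measure ℝ).prod (μ : Measure ℝ)) := by
    ext μ
    rw [← lintegral_iSup (fun n => (continuous_truncatedKernel hV C n).measurable.coe_nnreal_ennreal)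
      fun m n h p => ENNReal.coe_le_coe.2 (monotone_truncatedKernel V C h p)]
    exact lintegral_congr fun p => (iSup_truncatedKernel V C p).symm
  rw [h]
  refine lowerSemicontinuous_iSup fun n => Continuous.lowerSemicontinuous ?_
  let f : BoundedContinuousFunction (ℝ × ℝ) NNReal :=
    BoundedContinuousFunction.mkOfBound ⟨_, continuous_truncatedKernel hV C n⟩ n fun x y => by
      have hx : truncatedKernel V C n x ≤ n := min_le_right _ _
      have hy : truncatedKernel V C n y ≤ n := min_le_right _ _
      rw [NNReal.dist_eq, abs_le]
      have hx' : (truncatedKernel V C n x : ℝ) ≤ n := by exact_mod_cast hx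
      have hy' : (truncatedKernel V C n y : ℝ) ≤ n := by exact_mod_cast hy
      have := (truncatedKernel V C n x).coe_nonneg
      have := (truncatedKernel V C n y).coe_nonneg
      simp only [ContinuousMap.coe_mk]
      constructor <;> linarith
  have hdiag : Continuous fun μ : ProbabilityMeasure ℝ => μ.prod μ :=
    ProbabilityMeasure.continuous_prod.comp (continuous_id.prodMk continuous_id)
  exact (ProbabilityMeasure.continuous_lintegral_boundedContinuousFunction f).comp hdiag

lemma exists_isMinOn_shiftedEnergy {V : ℝ → ℝ} (hV : Continuous V) (C : ℝ) {K : Set ℝ}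
    (hK : IsCompact K) {ρ : Measure ℝ} [IsProbabilityMeasure ρ] (hρ : ρ Kᶜ = 0) :
    ∃ μ : Measure ℝ, IsProbabilityMeasure μ ∧ μ Kᶜ = 0 ∧
      ∀ ν : Measure ℝ, IsProbabilityMeasure ν → ν Kᶜ = 0 →
        shiftedEnergy V C μ ≤ shiftedEnergy V C ν := by
  have hcomp : IsCompact {μ : ProbabilityMeasure ℝ | ∀ _ : ℕ, μ Kᶜ ≤ 0} :=
    isCompact_setOfPred_probabilityMeasure_mass_eq_compl_isCompact_le (u := fun _ => 0)
      tendsto_const_nhds (fun _ => hK) (Or.inl inferInstance)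
  have hmem : ∀ μ : ProbabilityMeasure ℝ,
      μ ∈ {μ : ProbabilityMeasure ℝ | ∀ _ : ℕ, μ Kᶜ ≤ 0} ↔ (μ : Measure ℝ) Kᶜ = 0 := by
    intro μ
    simp [ProbabilityMeasure.null_iff_toMeasure_null]
  obtain ⟨μ, hμ, hmin⟩ := LowerSemicontinuousOn.exists_isMinOn 
    ⟨⟨ρ, ‹_›⟩, (hmem ⟨ρ, ‹_›⟩).2 hρ⟩ hcomp
    ((lowerSemicontinuous_shiftedEnergy hV C).lowerSemicontinuousOn _)
  exact ⟨μ, μ.2, (hmem μ).1 hμ, fun ν hν hνK => hmin ((hmem ⟨ν, hν⟩).2 hνK)⟩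

lemma isProbabilityMeasure_volume_restrict_unit :
    IsProbabilityMeasure (volume.restrict (Icc (0 : ℝ) 1)) :=
  ⟨by simp⟩

lemma lintegral_log_lt_top (M : ℝ) :
    ∫⁻ u in Icc (-1 : ℝ) 1, ENNReal.ofReal (-Real.log |u| + M) < ⊤ := by
  have h : IntegrableOn (fun u : ℝ => -Real.log |u| + M) (Icc (-1) 1) := by
    rw [integrableOn_Icc_iff_integrableOn_Ioc,
      ← intervalIntegrable_iff_integrableOn_Ioc_of_le (by norm_num)]
    simp only [Real.log_abs]
    exact intervalIntegral.intervalIntegrable_log'.neg.add intervalIntegrable_const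
  exact h.lintegral_lt_top

lemma kernelV_le_on_unit {V : ℝ → ℝ} {M t s : ℝ} (ht : 0 ≤ t) (hs : 0 ≤ s) (hts : t ≠ s)
    (hVt : V t ≤ M) (hVs : V s ≤ M) : kernelV V t s ≤ -Real.log |t - s| + M := by
  have key : ∀ x y : ℝ, 0 ≤ y → y ≤ x → |x - y| ≤ |Real.exp x - Real.exp y| := by
    intro x y hy hxy
    have h1 : Real.exp x = Real.exp y * Real.exp (x - y) := by rw [← Real.exp_add]; ring_nf
    have h2 := Real.add_one_le_exp (x - y)
    have h3 := Real.one_le_exp hy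
    have h4 : x - y ≤ Real.exp x - Real.exp y := by
      rw [h1]; nlinarith
    rw [abs_of_nonneg (sub_nonneg.2 hxy)]
    exact h4.trans (le_abs_self _)
  have h : |t - s| ≤ |Real.exp t - Real.exp s| := by
    rcases le_total s t with h | h
    · exact key t s hs h
    · rw [abs_sub_comm t, abs_sub_comm (Real.exp t)]
      exact key s t ht h
  have := Real.log_le_log (abs_pos.2 (sub_ne_zero.2 hts)) h
  unfold kernelV
  linarith

lemma shiftedEnergy_unit_lt_top {V : ℝ → ℝ} (hV : Continuous V) (C : ℝ) :
    shiftedEnergy V C (volume.restrict (Icc (0 : ℝ) 1)) < ⊤ := by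
  have := isProbabilityMeasure_volume_restrict_unit
  obtain ⟨M, hM⟩ := (isCompact_Icc.image hV (s := Icc (0 : ℝ) 1)).bddAbove
  set g : ℝ → ℝ≥0∞ := (Icc (-1 : ℝ) 1).indicator
    fun u => ENNReal.ofReal (-Real.log |u| + (M + C)) with hg
  have hJ : ∫⁻ u, g u < ⊤ := by
    rw [hg, lintegral_indicator measurableSet_Icc]
    exact lintegral_log_lt_top _
  refine lt_of_le_of_lt ?_ hJ
  rw [shiftedEnergy, lintegral_prod _ (measurable_shiftedKernel hV.measurable C).aemeasurable]
  calc ∫⁻ t in Icc (0 : ℝ) 1, ∫⁻ s in Icc (0 : ℝ) 1, shiftedKernel V C (t, s)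
      ≤ ∫⁻ _ in Icc (0 : ℝ) 1, ∫⁻ u, g u := by
        refine setLIntegral_mono' measurableSet_Icc fun t ht => ?_
        rw [← lintegral_sub_left_eq_self g t]
        refine le_trans ?_ (setLIntegral_le_lintegral (Icc 0 1) _)
        refine lintegral_mono_ae ?_
        have hne : ∀ᵐ s : ℝ ∂volume.restrict (Icc (0 : ℝ) 1), s ≠ t :=
          ae_restrict_of_ae (Measure.ae_ne volume t)
        filter_upwards [hne, ae_restrict_mem measurableSet_Icc] with s hst hs
        have hmem : t - s ∈ Icc (-1 : ℝ) 1 := ⟨by linarith [ht.1, hs.2], by linarith [ht.2, hs.1]⟩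
        simp only [shiftedKernel, if_neg hst.symm, hg, indicator_of_mem hmem]
        refine ENNReal.ofReal_le_ofReal ?_
        linarith [kernelV_le_on_unit ht.1 hs.1 hst.symm (hM (mem_image_of_mem V ht))
          (hM (mem_image_of_mem V hs))]
    _ = ∫⁻ u, g u := by simp

lemma setLIntegral_prod_eq_cond {ν : Measure ℝ} [IsProbabilityMeasure ν] {K : Set ℝ}
    (f : ℝ × ℝ → ℝ≥0∞) (h0 : ν K ≠ 0) :
    ∫⁻ p in K ×ˢ K, f p ∂(ν.prod ν) =
      ν K * (ν K * ∫⁻ p, f p ∂((ProbabilityTheory.cond ν K).prod (ProbabilityTheory.cond ν K))) := by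
  have h : ν.restrict K = ν K • ProbabilityTheory.cond ν K := by
    rw [ProbabilityTheory.cond, smul_smul, ENNReal.mul_inv_cancel h0 (measure_ne_top _ _), one_smul]
  have := ProbabilityTheory.cond_isProbabilityMeasure h0
  rw [← Measure.prod_restrict, h, Measure.prod_smul_left, Measure.prod_smul_right,
    lintegral_smul_measure, lintegral_smul_measure, smul_eq_mul, smul_eq_mul]

lemma exists_shiftedEnergy_le_of_compact {V : ℝ → ℝ} {B : ℝ}
    (hB : ∀ t s, |t| + |s| - B ≤ kernelV V t s) {R : ℝ} (hR : 0 ≤ R) (ν : Measure ℝ)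
    [IsProbabilityMeasure ν] (hν : shiftedEnergy V B ν ≤ ENNReal.ofReal R) :
    ∃ ν' : Measure ℝ, IsProbabilityMeasure ν' ∧ ν' (Icc (-(R + 1)) (R + 1))ᶜ = 0 ∧
      shiftedEnergy V B ν' ≤ shiftedEnergy V B ν ∧
      (shiftedEnergy V B ν ≤ shiftedEnergy V B ν' → ν (Icc (-(R + 1)) (R + 1))ᶜ = 0) := by
  set K := Icc (-(R + 1)) (R + 1) with hKdef
  have hK : MeasurableSet K := measurableSet_Icc
  have hout : ∀ p ∈ (K ×ˢ K)ᶜ, ENNReal.ofReal (R + 1) ≤ shiftedKernel V B p := by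
    rintro ⟨t, s⟩ hp
    unfold shiftedKernel
    split_ifs
    · exact le_top
    · refine ENNReal.ofReal_le_ofReal (le_trans ?_ (by linarith [hB t s] :
        |t| + |s| ≤ kernelV V t s + B))
      by_contra! hlt
      refine hp ⟨abs_le.1 ?_, abs_le.1 ?_⟩
      · linarith [abs_nonneg s]
      · linarith [abs_nonneg t]
  have hsplit : (∫⁻ p in K ×ˢ K, shiftedKernel V B p ∂(ν.prod ν))
      + ENNReal.ofReal (R + 1) * (ν.prod ν) (K ×ˢ K)ᶜ ≤ shiftedEnergy V B ν := by
    rw [shiftedEnergy, ← lintegral_add_compl (shiftedKernel V B) (hK.prod hK) (μ := ν.prod ν)]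
    refine add_le_add_right ?_ _
    rw [← setLIntegral_const]
    exact setLIntegral_mono' (hK.prod hK).compl hout
  have hcompl : (ν.prod ν) (K ×ˢ K)ᶜ = 1 - ν K * ν K := by
    rw [prob_compl_eq_one_sub (hK.prod hK), Measure.prod_prod]
  have hlt : ENNReal.ofReal R < ENNReal.ofReal (R + 1) :=
    (ENNReal.ofReal_lt_ofReal_iff (by linarith)).2 (by linarith)
  have h0 : ν K ≠ 0 := by
    intro h0
    rw [hcompl, h0] at hsplit
    simp only [mul_zero, tsub_zero, mul_one] at hsplit
    exact absurd ((le_add_self.trans hsplit).trans hν) hlt.not_ge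
  have hprob := ProbabilityTheory.cond_isProbabilityMeasure h0
  set ν' := ProbabilityTheory.cond ν K with hν'
  rw [setLIntegral_prod_eq_cond _ h0, hcompl] at hsplit
  change ν K * (ν K * shiftedEnergy V B ν') + _ ≤ _ at hsplit
  have ha1 : ν K ≤ 1 := prob_le_one
  have hfin : shiftedEnergy V B ν ≠ ⊤ := ne_top_of_le_ne_top ENNReal.ofReal_ne_top hν
  have hfin' : shiftedEnergy V B ν' ≠ ⊤ := by
    intro h
    rw [h, ENNReal.mul_top h0, ENNReal.mul_top h0, top_add] at hsplit
    exact hfin (top_le_iff.1 hsplit)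
  have hKc : ν Kᶜ = 1 - ν K := prob_compl_eq_one_sub hK
  have hKc' : ν' Kᶜ = 0 := by
    rw [hν', ProbabilityTheory.cond_apply hK]; simp
  refine ⟨ν', hprob, hKc', ?_⟩
  clear_value ν'
  generalize shiftedEnergy V B ν = y at *
  generalize shiftedEnergy V B ν' = x at *
  have ha_top : ν K ≠ ⊤ := measure_ne_top _ _
  generalize ν K = a at *
  lift a to NNReal using ha_top
  lift x to NNReal using hfin'
  lift y to NNReal using hfin
  have ha1' : a ≤ 1 := by exact_mod_cast ha1
  have haa : a * a ≤ 1 := mul_le_one' ha1' ha1'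
  have ha0 : 0 < (a : ℝ) := by
    have : a ≠ 0 := by exact_mod_cast h0
    positivity
  rw [ENNReal.ofReal, ← ENNReal.coe_one, ← ENNReal.coe_mul, ← ENNReal.coe_mul, ← ENNReal.coe_mul,
    ← ENNReal.coe_sub, ← ENNReal.coe_mul, ← ENNReal.coe_add, ENNReal.coe_le_coe,
    ← NNReal.coe_le_coe] at hsplit
  simp only [NNReal.coe_add, NNReal.coe_mul, NNReal.coe_sub haa, NNReal.coe_one,
    Real.coe_toNNReal _ (by linarith : 0 ≤ R + 1)] at hsplit
  rw [ENNReal.ofReal, ENNReal.coe_le_coe, ← NNReal.coe_le_coe, Real.coe_toNNReal _ hR] at hν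
  have haa' : (a : ℝ) * a ≤ 1 := by exact_mod_cast haa
  refine ⟨?_, fun hyx => ?_⟩
  · rw [ENNReal.coe_le_coe, ← NNReal.coe_le_coe]
    by_contra! hlt
    nlinarith [mul_pos ha0 ha0]
  · rw [ENNReal.coe_le_coe, ← NNReal.coe_le_coe] at hyx
    have h1 : (a : ℝ) * a = 1 := by nlinarith [mul_pos ha0 ha0]
    have h2 : (a : ℝ) = 1 := by nlinarith
    have h3 : a = 1 := by exact_mod_cast h2
    rw [hKc, h3]
    simp

/-- The two-measure form of convexity of the energy with kernel `k`. -/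
def MutualEnergyLE (k : ℝ × ℝ → ℝ≥0∞) (μ ν : Measure ℝ) : Prop :=
  2 * ∫⁻ p, k p ∂(μ.prod ν) ≤ (∫⁻ p, k p ∂(μ.prod μ)) + ∫⁻ p, k p ∂(ν.prod ν)

lemma ENNReal_two_mul_le_add_mul_self (a b : ℝ≥0∞) : 2 * (a * b) ≤ a * a + b * b := by
  wlog h : a ≤ b generalizing a b
  · rw [mul_comm a b, add_comm]
    exact this b a (le_of_not_ge h)
  obtain ⟨c, rfl⟩ := exists_add_of_le h
  calc 2 * (a * (a + c)) ≤ 2 * (a * (a + c)) + c * c := le_self_add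
    _ = _ := by ring

lemma ENNReal_eq_of_two_mul_eq {a b : ℝ≥0∞} (ha : a ≠ ⊤) (hb : b ≠ ⊤)
    (h : 2 * (a * b) = a * a + b * b) : a = b := by
  lift a to NNReal using ha
  lift b to NNReal using hb
  have h' : 2 * ((a : ℝ) * b) = a * a + b * b := by exact_mod_cast h
  have : (a : ℝ) = b := by nlinarith [sq_nonneg ((a : ℝ) - b)]
  exact_mod_cast this

section Gram

variable {W : Type*} [MeasurableSpace W] {m : Measure W} [SFinite m] {φ : W → ℝ → ℝ≥0∞}

lemma lintegral_gram (hφ : Measurable (Function.uncurry φ)) (μ ν : Measure ℝ) [SFinite μ]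
    [SFinite ν] :
    ∫⁻ p, ∫⁻ w, φ w p.1 * φ w p.2 ∂m ∂(μ.prod ν) =
      ∫⁻ w, (∫⁻ t, φ w t ∂μ) * (∫⁻ s, φ w s ∂ν) ∂m := by
  rw [lintegral_lintegral_swap]
  · refine lintegral_congr fun w => ?_
    have hw : Measurable (φ w) := hφ.comp measurable_prodMk_left
    exact lintegral_prod_mul hw.aemeasurable hw.aemeasurable
  · refine Measurable.aemeasurable ?_
    exact (hφ.comp (measurable_snd.prodMk (measurable_fst.comp measurable_fst))).mul
      (hφ.comp (measurable_snd.prodMk (measurable_snd.comp measurable_fst)))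

lemma measurable_gram (hφ : Measurable (Function.uncurry φ)) :
    Measurable fun p : ℝ × ℝ => ∫⁻ w, φ w p.1 * φ w p.2 ∂m := by
  refine Measurable.lintegral_prod_right ?_
  exact (hφ.comp (measurable_snd.prodMk (measurable_fst.comp measurable_fst))).mul
    (hφ.comp (measurable_snd.prodMk (measurable_snd.comp measurable_fst)))

lemma mutualEnergyLE_gram (hφ : Measurable (Function.uncurry φ)) (μ ν : Measure ℝ) [SFinite μ]
    [SFinite ν] : MutualEnergyLE (fun p => ∫⁻ w, φ w p.1 * φ w p.2 ∂m) μ ν := by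
  have hF : ∀ (ρ σ : Measure ℝ) [SFinite ρ] [SFinite σ],
      Measurable fun w => (∫⁻ t, φ w t ∂ρ) * ∫⁻ t, φ w t ∂σ := fun ρ σ _ _ =>
    (Measurable.lintegral_prod_right hφ).mul (Measurable.lintegral_prod_right hφ)
  rw [MutualEnergyLE, lintegral_gram hφ, lintegral_gram hφ, lintegral_gram hφ,
    ← lintegral_add_left (hF μ μ), ← lintegral_const_mul _ (hF μ ν)]
  exact lintegral_mono fun w => ENNReal_two_mul_le_add_mul_self _ _

lemma ae_eq_of_gram_add {k : ℝ × ℝ → ℝ≥0∞} (hφ : Measurable (Function.uncurry φ))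
    (hk : Measurable k) {μ ν : Measure ℝ} [SFinite μ] [SFinite ν] (hkμν : MutualEnergyLE k μ ν)
    (hμ : ∫⁻ p, ((∫⁻ w, φ w p.1 * φ w p.2 ∂m) + k p) ∂(μ.prod μ) ≠ ⊤)
    (hν : ∫⁻ p, ((∫⁻ w, φ w p.1 * φ w p.2 ∂m) + k p) ∂(ν.prod ν) ≠ ⊤)
    (hle : (∫⁻ p, ((∫⁻ w, φ w p.1 * φ w p.2 ∂m) + k p) ∂(μ.prod μ))
        + ∫⁻ p, ((∫⁻ w, φ w p.1 * φ w p.2 ∂m) + k p) ∂(ν.prod ν)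
      ≤ 2 * ∫⁻ p, ((∫⁻ w, φ w p.1 * φ w p.2 ∂m) + k p) ∂(μ.prod ν)) :
    ∀ᵐ w ∂m, 2 * ((∫⁻ t, φ w t ∂μ) * ∫⁻ t, φ w t ∂ν) =
      (∫⁻ t, φ w t ∂μ) * (∫⁻ t, φ w t ∂μ) + (∫⁻ t, φ w t ∂ν) * ∫⁻ t, φ w t ∂ν := by
  have hF : ∀ (ρ σ : Measure ℝ) [SFinite ρ] [SFinite σ],
      Measurable fun w => (∫⁻ t, φ w t ∂ρ) * ∫⁻ t, φ w t ∂σ := fun ρ σ _ _ =>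
    (Measurable.lintegral_prod_right hφ).mul (Measurable.lintegral_prod_right hφ)
  have hG := mutualEnergyLE_gram (m := m) hφ μ ν
  unfold MutualEnergyLE at hG hkμν
  rw [lintegral_add_right _ hk] at hμ hν
  simp only [lintegral_add_right _ hk] at hle
  have hle' : (∫⁻ p, (∫⁻ w, φ w p.1 * φ w p.2 ∂m) ∂(μ.prod μ))
      + (∫⁻ p, (∫⁻ w, φ w p.1 * φ w p.2 ∂m) ∂(ν.prod ν))
      ≤ 2 * ∫⁻ p, (∫⁻ w, φ w p.1 * φ w p.2 ∂m) ∂(μ.prod ν) := by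
    have hfin : (∫⁻ p, k p ∂(μ.prod μ)) + ∫⁻ p, k p ∂(ν.prod ν) ≠ ⊤ :=
      ENNReal.add_ne_top.2 ⟨(ENNReal.add_ne_top.1 hμ).2, (ENNReal.add_ne_top.1 hν).2⟩
    refine (ENNReal.add_le_add_iff_right hfin).1 ?_
    rw [add_add_add_comm]
    refine hle.trans ?_
    rw [mul_add]
    exact add_le_add le_rfl hkμν
  rw [lintegral_gram hφ, lintegral_gram hφ, lintegral_gram hφ,
    ← lintegral_add_left (hF μ μ), ← lintegral_const_mul _ (hF μ ν)] at hle'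
  refine ae_eq_of_ae_le_of_lintegral_le (.of_forall fun w => ENNReal_two_mul_le_add_mul_self _ _)
    ?_ ?_ hle'
  · rw [lintegral_const_mul _ (hF μ ν), ← lintegral_gram hφ]
    exact ne_top_of_le_ne_top
      (ENNReal.add_ne_top.2 ⟨(ENNReal.add_ne_top.1 hμ).1, (ENNReal.add_ne_top.1 hν).1⟩) hG
  · exact ((hF μ μ).add (hF ν ν)).aemeasurable

end Gram

lemma MutualEnergyLE.add {k l : ℝ × ℝ → ℝ≥0∞} {μ ν : Measure ℝ} (hk : MutualEnergyLE k μ ν)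
    (hl : MutualEnergyLE l μ ν) (hlm : Measurable l) : MutualEnergyLE (fun p => k p + l p) μ ν := by
  unfold MutualEnergyLE at *
  simp only [lintegral_add_right _ hlm]
  rw [mul_add, add_add_add_comm]
  exact add_le_add hk hl

lemma MutualEnergyLE.const_mul {k : ℝ × ℝ → ℝ≥0∞} {μ ν : Measure ℝ} (hk : MutualEnergyLE k μ ν)
    (hkm : Measurable k) (c : ℝ≥0∞) : MutualEnergyLE (fun p => c * k p) μ ν := by
  unfold MutualEnergyLE at *
  simp only [lintegral_const_mul _ hkm]
  rw [mul_left_comm, ← mul_add]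
  exact mul_le_mul_right hk c

lemma mutualEnergyLE_add_separate {v : ℝ → ℝ≥0∞} (hv : Measurable v) (μ ν : Measure ℝ)
    [IsProbabilityMeasure μ] [IsProbabilityMeasure ν] :
    MutualEnergyLE (fun p => v p.1 + v p.2) μ ν := by
  have h : ∀ (ρ σ : Measure ℝ) [IsProbabilityMeasure ρ] [IsProbabilityMeasure σ],
      ∫⁻ p, (v p.1 + v p.2) ∂(ρ.prod σ) = (∫⁻ t, v t ∂ρ) + ∫⁻ t, v t ∂σ := by
    intro ρ σ _ _
    have hv1 : Measurable fun p : ℝ × ℝ => v p.1 := hv.comp measurable_fst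
    rw [lintegral_add_left hv1, measurePreserving_fst.lintegral_comp hv, measurePreserving_snd.lintegral_comp hv]
  rw [MutualEnergyLE, h, h, h, two_mul, add_add_add_comm]

lemma lintegral_prod_comm_of_symm {k : ℝ × ℝ → ℝ≥0∞} (hsymm : ∀ t s, k (t, s) = k (s, t))
    (μ ν : Measure ℝ) [SFinite μ] [SFinite ν] :
    ∫⁻ p, k p ∂(ν.prod μ) = ∫⁻ p, k p ∂(μ.prod ν) := by
  rw [← lintegral_prod_swap]
  exact lintegral_congr fun p => hsymm _ _

lemma lintegral_midpoint {k : ℝ × ℝ → ℝ≥0∞} (hsymm : ∀ t s, k (t, s) = k (s, t))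
    (μ ν : Measure ℝ) [SFinite μ] [SFinite ν] :
    ∫⁻ p, k p ∂(((2⁻¹ : ℝ≥0∞) • (μ + ν)).prod ((2⁻¹ : ℝ≥0∞) • (μ + ν))) =
      2⁻¹ * (2⁻¹ * ((∫⁻ p, k p ∂(μ.prod μ)) + (∫⁻ p, k p ∂(ν.prod ν))
        + 2 * ∫⁻ p, k p ∂(μ.prod ν))) := by
  rw [Measure.prod_smul_left, Measure.prod_smul_right, lintegral_smul_measure,
    lintegral_smul_measure, Measure.prod_add, Measure.add_prod, Measure.add_prod,
    lintegral_add_measure, lintegral_add_measure, lintegral_add_measure,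
    lintegral_prod_comm_of_symm hsymm μ ν, smul_eq_mul, smul_eq_mul]
  ring

/-- Indicator of `t ≤ y ≤ t + r`, as a function of `t`. -/
noncomputable def window (r y t : ℝ) : ℝ≥0∞ := (Icc t (t + r)).indicator 1 y

lemma measurable_window {α : Type*} [MeasurableSpace α] {r y t : α → ℝ} (hr : Measurable r)
    (hy : Measurable y) (ht : Measurable t) : Measurable fun a => window (r a) (y a) (t a) := by
  have : MeasurableSet {a | t a ≤ y a ∧ y a ≤ t a + r a} :=
    (measurableSet_le ht hy).inter (measurableSet_le hy (ht.add hr))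
  exact measurable_const.indicator (f := fun _ => (1 : ℝ≥0∞)) this

lemma lintegral_window (r y : ℝ) (μ : Measure ℝ) :
    ∫⁻ t, window r y t ∂μ = μ (Icc (y - r) y) := by
  rw [← lintegral_indicator_one measurableSet_Icc]
  refine lintegral_congr fun t => ?_
  unfold window
  have : y ∈ Icc t (t + r) ↔ t ∈ Icc (y - r) y := by
    simp only [mem_Icc]
    constructor <;> rintro ⟨h1, h2⟩ <;> constructor <;> linarith
  by_cases h : y ∈ Icc t (t + r)
  · rw [indicator_of_mem h, indicator_of_mem (this.1 h)]; rfl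
  · rw [indicator_of_notMem h, indicator_of_notMem (mt this.2 h)]

lemma lintegral_window_mul_window (r t s : ℝ) :
    ∫⁻ y, window r y t * window r y s = ENNReal.ofReal (r - |t - s|) := by
  have h : ∀ y, window r y t * window r y s
      = (Icc (max t s) (min (t + r) (s + r))).indicator 1 y := by
    intro y
    rw [← Icc_inter_Icc, inter_indicator_one]
    rfl
  simp_rw [h]
  rw [lintegral_indicator_one measurableSet_Icc, Real.volume_Icc, min_add_add_right, ← max_sub_min_eq_abs]
  congr 1
  rw [max_comm, min_comm]
  ring

lemma lintegral_triangle {L x : ℝ} (hx : 0 < x) (hxL : x ≤ L) :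
    ∫⁻ r in Ioc 0 L, ENNReal.ofReal (1 / r) * ENNReal.ofReal (1 / r) * ENNReal.ofReal (r - x)
      = ENNReal.ofReal (Real.log L - Real.log x - 1 + x / L) := by
  have hL : 0 < L := hx.trans_le hxL
  rw [← Ioc_union_Ioc_eq_Ioc hx.le hxL,
    lintegral_union measurableSet_Ioc (Ioc_disjoint_Ioc_of_le le_rfl)]
  have h0 : ∫⁻ r in Ioc 0 x,
      ENNReal.ofReal (1 / r) * ENNReal.ofReal (1 / r) * ENNReal.ofReal (r - x) = 0 := by
    rw [setLIntegral_congr_fun (g := fun _ => 0) measurableSet_Ioc]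
    · simp
    · intro r hr
      simp only [ENNReal.ofReal_of_nonpos (sub_nonpos.2 hr.2), mul_zero]
  have h1 : ∫⁻ r in Ioc x L,
      ENNReal.ofReal (1 / r) * ENNReal.ofReal (1 / r) * ENNReal.ofReal (r - x)
      = ∫⁻ r in Ioc x L, ENNReal.ofReal (1 / r - x / r ^ 2) := by
    refine setLIntegral_congr_fun measurableSet_Ioc fun r hr => ?_
    have hr0 : 0 < r := hx.trans hr.1
    rw [← ENNReal.ofReal_mul (by positivity), ← ENNReal.ofReal_mul (by positivity)]
    congr 1
    field_simp
  have hderiv : ∀ r ∈ uIcc x L,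
      HasDerivAt (fun r => Real.log r + x / r) (1 / r - x / r ^ 2) r := by
    intro r hr
    rw [uIcc_of_le hxL] at hr
    have hr0 : r ≠ 0 := (hx.trans_le hr.1).ne'
    have := (Real.hasDerivAt_log hr0).add ((hasDerivAt_inv hr0).const_mul x)
    refine (this.congr_deriv ?_).congr_of_eventuallyEq (.of_forall fun y => ?_)
    · field_simp
      ring
    · simp [div_eq_mul_inv]
  have hcont : ContinuousOn (fun r : ℝ => 1 / r - x / r ^ 2) (uIcc x L) := by
    rw [uIcc_of_le hxL]
    have : ∀ r ∈ Icc x L, r ≠ 0 := fun r hr => (hx.trans_le hr.1).ne'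
    exact (continuousOn_const.div continuousOn_id this).sub
      (continuousOn_const.div (by fun_prop) fun r hr => pow_ne_zero 2 (this r hr))
  have hint := hcont.intervalIntegrable (μ := volume)
  rw [h0, h1, zero_add, ← ofReal_integral_eq_lintegral_ofReal
    ((intervalIntegrable_iff_integrableOn_Ioc_of_le hxL).1 hint),
    ← intervalIntegral.integral_of_le hxL, intervalIntegral.integral_eq_sub_of_hasDerivAt hderiv hint]
  · congr 1
    rw [div_self hx.ne']
    ring
  · refine (ae_restrict_mem measurableSet_Ioc).mono fun r hr => ?_
    have hr0 : 0 < r := hx.trans hr.1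
    have : 1 / r - x / r ^ 2 = (r - x) / r ^ 2 := by field_simp
    simp only [Pi.zero_apply]
    rw [this]
    exact div_nonneg (sub_nonneg.2 hr.1.le) (by positivity)

lemma lintegral_triangle_zero {L : ℝ} (hL : 0 < L) :
    ∫⁻ r in Ioc 0 L, ENNReal.ofReal (1 / r) * ENNReal.ofReal (1 / r) * ENNReal.ofReal (r - 0)
      = ⊤ := by
  refine ENNReal.eq_top_of_forall_nnreal_le fun N => ?_
  have hx : 0 < L * Real.exp (-(N + 1)) := by positivity
  have hxL : L * Real.exp (-(N + 1)) ≤ L :=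
    mul_le_of_le_one_right hL.le (Real.exp_le_one_iff.2 (by linarith [N.coe_nonneg]))
  calc (N : ℝ≥0∞) = ENNReal.ofReal N := (ENNReal.ofReal_coe_nnreal).symm
    _ ≤ _ := ENNReal.ofReal_le_ofReal ?_
    _ = _ := (lintegral_triangle hx hxL).symm
    _ ≤ _ := lintegral_mono fun r => ?_
  · rw [Real.log_mul hL.ne' (Real.exp_pos _).ne', Real.log_exp]
    have : 0 ≤ L * Real.exp (-(N + 1)) / L := by positivity
    linarith
  · refine mul_le_mul_right (ENNReal.ofReal_le_ofReal ?_) _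
    linarith

/-- The kernel `log (L / |t - s|)`, valued in `ℝ≥0∞`, with value `⊤` on the diagonal. -/
noncomputable def logKernel (L : ℝ) (p : ℝ × ℝ) : ℝ≥0∞ :=
  if p.1 = p.2 then ⊤ else ENNReal.ofReal (Real.log L - Real.log |p.1 - p.2|)

/-- The triangular kernel `(1 - |t - s| / L)₊` as a Gram kernel. -/
noncomputable def triangleKernel (L : ℝ) (p : ℝ × ℝ) : ℝ≥0∞ :=
  ∫⁻ y, window L y p.1 * window L y p.2 ∂(ENNReal.ofReal (1 / L) • volume)

/-- A superposition of triangular kernels at all scales up to `L`, as a Gram kernel. -/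
noncomputable def multiscaleKernel (L : ℝ) (p : ℝ × ℝ) : ℝ≥0∞ :=
  ∫⁻ w : ℝ × ℝ, (ENNReal.ofReal (1 / w.1) * window w.1 w.2 p.1)
    * (ENNReal.ofReal (1 / w.1) * window w.1 w.2 p.2) ∂((volume.restrict (Ioc 0 L)).prod volume)

lemma triangleKernel_eq (L : ℝ) (p : ℝ × ℝ) :
    triangleKernel L p = ENNReal.ofReal (1 / L) * ENNReal.ofReal (L - |p.1 - p.2|) := by
  rw [triangleKernel, lintegral_smul_measure, lintegral_window_mul_window, smul_eq_mul]

lemma multiscaleKernel_eq (L : ℝ) (p : ℝ × ℝ) :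
    multiscaleKernel L p = ∫⁻ r in Ioc 0 L,
      ENNReal.ofReal (1 / r) * ENNReal.ofReal (1 / r) * ENNReal.ofReal (r - |p.1 - p.2|) := by
  have hw : ∀ t : ℝ, Measurable fun w : ℝ × ℝ => window w.1 w.2 t := fun t =>
    measurable_window measurable_fst measurable_snd measurable_const
  have h1 : ∀ t, Measurable fun w : ℝ × ℝ => ENNReal.ofReal (1 / w.1) * window w.1 w.2 t :=
    fun t => Measurable.mul (by fun_prop) (hw t)
  have h2 : Measurable fun w : ℝ × ℝ => (ENNReal.ofReal (1 / w.1) * window w.1 w.2 p.1)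
      * (ENNReal.ofReal (1 / w.1) * window w.1 w.2 p.2) := (h1 _).mul (h1 _)
  rw [multiscaleKernel, lintegral_prod _ h2.aemeasurable]
  refine lintegral_congr fun r => ?_
  rw [← lintegral_window_mul_window, ← lintegral_const_mul]
  · exact lintegral_congr fun y => mul_mul_mul_comm _ _ _ _
  · exact (measurable_window measurable_const measurable_id measurable_const).mul
      (measurable_window measurable_const measurable_id measurable_const)

lemma logKernel_eq {L : ℝ} (hL : 0 < L) {p : ℝ × ℝ} (hp : |p.1 - p.2| ≤ L) :
    logKernel L p = triangleKernel L p + multiscaleKernel L p := by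
  rw [triangleKernel_eq, multiscaleKernel_eq, logKernel]
  split_ifs with h
  · rw [h, sub_self, abs_zero, lintegral_triangle_zero hL, add_top]
  · have hx : 0 < |p.1 - p.2| := abs_pos.2 (sub_ne_zero.2 h)
    have hlog := Real.log_le_sub_one_of_pos (div_pos hx hL)
    rw [Real.log_div hx.ne' hL.ne'] at hlog
    rw [lintegral_triangle hx hp, ← ENNReal.ofReal_mul (by positivity),
      ← ENNReal.ofReal_add]
    · congr 1
      field_simp
      ring
    · exact mul_nonneg (by positivity) (sub_nonneg.2 hp)
    · linarith

lemma measurable_windowUncurry (L : ℝ) {f : ℝ → ℝ} (hf : Measurable f) :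
    Measurable (Function.uncurry fun y t => window L y (f t)) :=
  measurable_window measurable_const measurable_fst (hf.comp measurable_snd)

lemma measurable_scaledWindowUncurry {f : ℝ → ℝ} (hf : Measurable f) :
    Measurable (Function.uncurry fun (w : ℝ × ℝ) t =>
      ENNReal.ofReal (1 / w.1) * window w.1 w.2 (f t)) := by
  have h1 : Measurable fun w : (ℝ × ℝ) × ℝ => ENNReal.ofReal (1 / w.1.1) := by fun_prop
  exact h1.mul (measurable_window (measurable_fst.comp measurable_fst)
    (measurable_snd.comp measurable_fst) (hf.comp measurable_snd))

lemma mutualEnergyLE_multiscaleKernel (L : ℝ) {f : ℝ → ℝ} (hf : Measurable f) (μ ν : Measure ℝ)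
    [SFinite μ] [SFinite ν] : MutualEnergyLE (fun p => multiscaleKernel L (f p.1, f p.2)) μ ν :=
  mutualEnergyLE_gram (measurable_scaledWindowUncurry hf) μ ν

lemma mutualEnergyLE_triangleKernel (L : ℝ) {f : ℝ → ℝ} (hf : Measurable f) (μ ν : Measure ℝ)
    [SFinite μ] [SFinite ν] : MutualEnergyLE (fun p => triangleKernel L (f p.1, f p.2)) μ ν :=
  mutualEnergyLE_gram (measurable_windowUncurry L hf) μ ν

lemma measurable_multiscaleKernel (L : ℝ) : Measurable (multiscaleKernel L) :=
  measurable_gram (measurable_scaledWindowUncurry measurable_id)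

lemma measurable_triangleKernel (L : ℝ) : Measurable (triangleKernel L) :=
  measurable_gram (measurable_windowUncurry L measurable_id)

lemma shiftedKernel_eq {V : ℝ → ℝ} {B L L' t s : ℝ} (hB : ∀ x, 0 ≤ V x + B)
    (hts : |t - s| ≤ L) (hexp : |Real.exp t - Real.exp s| ≤ L') :
    shiftedKernel V (B + (1/2 * Real.log L + 1/2 * Real.log L')) (t, s) =
      ENNReal.ofReal (1/2) * logKernel L (t, s)
        + ENNReal.ofReal (1/2) * logKernel L' (Real.exp t, Real.exp s)
        + (ENNReal.ofReal (1/2 * (V t + B)) + ENNReal.ofReal (1/2 * (V s + B))) := by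
  unfold shiftedKernel logKernel
  by_cases h : t = s
  · have : ENNReal.ofReal (1/2) ≠ 0 := by simp
    simp [h, ENNReal.mul_top]
  · have h1 : 0 < |t - s| := abs_pos.2 (sub_ne_zero.2 h)
    have hne : Real.exp t ≠ Real.exp s := Real.exp_injective.ne h
    have h2 : 0 < |Real.exp t - Real.exp s| := abs_pos.2 (sub_ne_zero.2 hne)
    have h3 := Real.log_le_log h1 hts
    have h4 := Real.log_le_log h2 hexp
    have h5 := hB t
    have h6 := hB s
    simp only [if_neg h, if_neg hne]
    rw [← ENNReal.ofReal_mul (by norm_num), ← ENNReal.ofReal_mul (by norm_num),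
      ← ENNReal.ofReal_add (by linarith) (by linarith),
      ← ENNReal.ofReal_add (by linarith) (by linarith),
      ← ENNReal.ofReal_add (by linarith) (by linarith)]
    congr 1
    unfold kernelV
    ring

lemma eq_of_ae_measure_Iic_eq {μ ν : Measure ℝ} [IsProbabilityMeasure μ] [IsProbabilityMeasure ν]
    (h : ∀ᵐ y : ℝ, μ (Iic y) = ν (Iic y)) : μ = ν := by
  refine Measure.eq_of_cdf μ ν (StieltjesFunction.ext fun y => ?_)
  have hdense := Measure.dense_of_ae h
  have hright : ∀ (ρ : Measure ℝ), Tendsto (ProbabilityTheory.cdf ρ) (𝓝[>] y)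
      (𝓝 (ProbabilityTheory.cdf ρ y)) := fun ρ =>
    ((ProbabilityTheory.cdf ρ).right_continuous y).mono_left (nhdsWithin_mono _ Ioi_subset_Ici_self)
  refine tendsto_nhds_unique_of_frequently_eq (hright μ) (hright ν) ?_
  rw [frequently_iff]
  intro U hU
  obtain ⟨u, hu, hsub⟩ := mem_nhdsGT_iff_exists_Ioo_subset.1 hU
  obtain ⟨x, hx, hxeq⟩ := hdense.inter_open_nonempty _ isOpen_Ioo (nonempty_Ioo.2 hu)
  refine ⟨x, hsub hx, ?_⟩
  rw [ProbabilityTheory.cdf_eq_real, ProbabilityTheory.cdf_eq_real, measureReal_def,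
    measureReal_def]
  exact congrArg ENNReal.toReal hxeq

lemma eq_of_ae_measure_Icc_eq {μ ν : Measure ℝ} [IsProbabilityMeasure μ] [IsProbabilityMeasure ν]
    {R : ℝ} (hμ : μ (Icc (-R) R)ᶜ = 0) (hν : ν (Icc (-R) R)ᶜ = 0)
    (h : ∀ᵐ y : ℝ, μ (Icc (y - 2 * R) y) = ν (Icc (y - 2 * R) y)) : μ = ν := by
  refine eq_of_ae_measure_Iic_eq (h.mono fun y hy => ?_)
  have key : ∀ (ρ : Measure ℝ) [IsProbabilityMeasure ρ], ρ (Icc (-R) R)ᶜ = 0 →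
      (y ≤ R → ρ (Iic y) = ρ (Icc (y - 2 * R) y)) ∧ (R < y → ρ (Iic y) = 1) := by
    intro ρ _ hρ
    have hae : ∀ᵐ x ∂ρ, x ∈ Icc (-R) R := hρ
    refine ⟨fun hyR => measure_congr ?_, fun hyR => ?_⟩
    · filter_upwards [hae] with x hx
      refine propext ⟨fun hxy => ⟨by linarith [hx.1], hxy⟩, fun hxy => hxy.2⟩
    · rw [← mem_ae_iff_prob_eq_one measurableSet_Iic]
      exact hae.mono fun x hx => hx.2.trans hyR.le
  rcases le_or_gt y R with hyR | hyR
  · rw [(key μ hμ).1 hyR, (key ν hν).1 hyR, hy]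
  · rw [(key μ hμ).2 hyR, (key ν hν).2 hyR]

lemma eq_of_isMin_shiftedEnergy {V : ℝ → ℝ} (hV : Continuous V) {B R : ℝ} (hR : 1 ≤ R)
    (hB : ∀ x, 0 ≤ V x + B) {μ ν : Measure ℝ} [IsProbabilityMeasure μ] [IsProbabilityMeasure ν]
    (hμ : μ (Icc (-R) R)ᶜ = 0) (hν : ν (Icc (-R) R)ᶜ = 0) {C : ℝ}
    (hC : C = B + (1/2 * Real.log (2 * R) + 1/2 * Real.log (Real.exp R)))
    (hfin : shiftedEnergy V C μ ≠ ⊤)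
    (hμmin : ∀ ρ : Measure ℝ, IsProbabilityMeasure ρ → shiftedEnergy V C μ ≤ shiftedEnergy V C ρ)
    (hνmin : ∀ ρ : Measure ℝ, IsProbabilityMeasure ρ → shiftedEnergy V C ν ≤ shiftedEnergy V C ρ) :
    μ = ν := by
  have heq : shiftedEnergy V C μ = shiftedEnergy V C ν :=
    le_antisymm (hμmin ν ‹_›) (hνmin μ ‹_›)
  have hmid : shiftedEnergy V C μ + shiftedEnergy V C ν
      ≤ 2 * ∫⁻ p, shiftedKernel V C p ∂(μ.prod ν) := by
    have hprob : IsProbabilityMeasure ((2⁻¹ : ℝ≥0∞) • (μ + ν)) := by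
      constructor
      simp only [Measure.smul_apply, Measure.add_apply, measure_univ, smul_eq_mul]
      rw [one_add_one_eq_two, ENNReal.inv_mul_cancel (by simp) (by simp)]
    have h := hμmin _ hprob
    rw [shiftedEnergy, shiftedEnergy, lintegral_midpoint (shiftedKernel_symm V C)] at h
    change shiftedEnergy V C μ ≤ 2⁻¹ * (2⁻¹ * (shiftedEnergy V C μ + shiftedEnergy V C ν + _)) at h
    rw [← heq] at h ⊢
    generalize (2 * ∫⁻ p, shiftedKernel V C p ∂(μ.prod ν)) = X at *
    generalize shiftedEnergy V C μ = x at *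
    induction X with
    | top => exact le_top
    | coe X =>
      lift x to NNReal using hfin
      have h2 : (2⁻¹ : ℝ≥0∞) = ((2⁻¹ : NNReal) : ℝ≥0∞) := by simp
      rw [h2] at h
      have h' : (x : ℝ) ≤ 2⁻¹ * (2⁻¹ * (x + x + X)) := by exact_mod_cast h
      have : (x : ℝ) + x ≤ X := by linarith
      exact_mod_cast this
  have hfin' : shiftedEnergy V C ν ≠ ⊤ := heq ▸ hfin
  set c := ENNReal.ofReal (1/2) with hc
  set m : Measure ℝ := (c * ENNReal.ofReal (1 / (2 * R))) • volume with hm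
  set v : ℝ → ℝ≥0∞ := fun t => ENNReal.ofReal (1/2 * (V t + B)) with hv
  have hvm : Measurable v := by
    have := hV.measurable
    fun_prop
  set k : ℝ × ℝ → ℝ≥0∞ := fun p => c * multiscaleKernel (2 * R) (p.1, p.2)
    + (c * triangleKernel (Real.exp R) (Real.exp p.1, Real.exp p.2)
    + (c * multiscaleKernel (Real.exp R) (Real.exp p.1, Real.exp p.2)
    + (v p.1 + v p.2))) with hk
  have hexp : Measurable fun p : ℝ × ℝ => (Real.exp p.1, Real.exp p.2) := by fun_prop
  have hk1 : Measurable fun p : ℝ × ℝ => multiscaleKernel (2 * R) (p.1, p.2) :=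
    measurable_multiscaleKernel _
  have hk2 : Measurable fun p : ℝ × ℝ =>
      triangleKernel (Real.exp R) (Real.exp p.1, Real.exp p.2) :=
    (measurable_triangleKernel _).comp hexp
  have hk3 : Measurable fun p : ℝ × ℝ =>
      multiscaleKernel (Real.exp R) (Real.exp p.1, Real.exp p.2) :=
    (measurable_multiscaleKernel _).comp hexp
  have hk4 : Measurable fun p : ℝ × ℝ => v p.1 + v p.2 :=
    (hvm.comp measurable_fst).add (hvm.comp measurable_snd)
  have hkm : Measurable k :=
    (hk1.const_mul c).add ((hk2.const_mul c).add ((hk3.const_mul c).add hk4))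
  have hkμν : MutualEnergyLE k μ ν :=
    ((mutualEnergyLE_multiscaleKernel _ measurable_id μ ν).const_mul hk1 c).add
      (((mutualEnergyLE_triangleKernel _ Real.measurable_exp μ ν).const_mul hk2 c).add
        (((mutualEnergyLE_multiscaleKernel _ Real.measurable_exp μ ν).const_mul hk3 c).add
          (mutualEnergyLE_add_separate hvm μ ν) hk4) ((hk3.const_mul c).add hk4))
      ((hk2.const_mul c).add ((hk3.const_mul c).add hk4))
  have hpt : ∀ t ∈ Icc (-R) R, ∀ s ∈ Icc (-R) R, shiftedKernel V C (t, s) =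
      (∫⁻ y, window (2 * R) y t * window (2 * R) y s ∂m) + k (t, s) := by
    intro t ht s hs
    have hts : |t - s| ≤ 2 * R :=
      abs_le.2 ⟨by linarith [ht.1, hs.2], by linarith [ht.2, hs.1]⟩
    have hexp : |Real.exp t - Real.exp s| ≤ Real.exp R := by
      have := Real.exp_le_exp.2 ht.2
      have := Real.exp_le_exp.2 hs.2
      exact abs_le.2 ⟨by linarith [Real.exp_pos t], by linarith [Real.exp_pos s]⟩
    have htri : triangleKernel (2 * R) (t, s) =
        ENNReal.ofReal (1 / (2 * R)) * ∫⁻ y, window (2 * R) y t * window (2 * R) y s := by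
      rw [triangleKernel, lintegral_smul_measure, smul_eq_mul]
    rw [hC, shiftedKernel_eq hB hts hexp,
      logKernel_eq (by linarith) hts, logKernel_eq (Real.exp_pos R) hexp, hm,
      lintegral_smul_measure, smul_eq_mul]
    simp only [hk]
    rw [htri]
    ring
  have hint : ∀ (ρ σ : Measure ℝ) [IsProbabilityMeasure ρ] [IsProbabilityMeasure σ],
      ρ (Icc (-R) R)ᶜ = 0 → σ (Icc (-R) R)ᶜ = 0 →
      ∫⁻ p, shiftedKernel V C p ∂(ρ.prod σ) =
        ∫⁻ p, ((∫⁻ y, window (2 * R) y p.1 * window (2 * R) y p.2 ∂m) + k p) ∂(ρ.prod σ) := by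
    intro ρ σ _ _ hρ hσ
    have h1 : ∀ᵐ p ∂(ρ.prod σ), p.1 ∈ Icc (-R) R := Measure.quasiMeasurePreserving_fst.ae hρ
    have h2 : ∀ᵐ p ∂(ρ.prod σ), p.2 ∈ Icc (-R) R := Measure.quasiMeasurePreserving_snd.ae hσ
    refine lintegral_congr_ae ?_
    filter_upwards [h1, h2] with p h1 h2
    exact hpt p.1 h1 p.2 h2
  have hae := ae_eq_of_gram_add (m := m) (φ := fun y t => window (2 * R) y t)
    (measurable_windowUncurry (2 * R) measurable_id) hkm hkμν
    (by rw [← hint μ μ hμ hμ]; exact hfin) (by rw [← hint ν ν hν hν]; exact hfin')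
    (by rw [← hint μ μ hμ hμ, ← hint ν ν hν hν, ← hint μ ν hμ hν]; exact hmid)
  have hvol : (volume : Measure ℝ) ≪ m := by
    refine Measure.absolutelyContinuous_smul (mul_ne_zero (by simp [hc]) ?_)
    simp only [ne_eq, ENNReal.ofReal_eq_zero, not_le]
    positivity
  refine eq_of_ae_measure_Icc_eq hμ hν ?_
  filter_upwards [hvol.ae_le hae] with y hy
  simp only [lintegral_window] at hy
  exact ENNReal_eq_of_two_mul_eq (measure_ne_top _ _) (measure_ne_top _ _) hy

/-- For a real analytic external field `V` with superlinear growth at `±∞`,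
there is a unique compactly supported Borel probability measure minimizing the energy `I_V`
among all Borel probability measures on `ℝ`; moreover every minimizer equals it. -/
theorem exists_unique_equilibrium_measure
    (V : ℝ → ℝ)
    (hanalytic : ∀ x : ℝ, AnalyticAt ℝ V x)
    (hgrowth : Tendsto (fun x => V x / (|x| + 1)) atTop atTop ∧
      Tendsto (fun x => V x / (|x| + 1)) atBot atTop) :
    ∃ μV : Measure ℝ, IsProbabilityMeasure μV ∧
      (∃ K : Set ℝ, IsCompact K ∧ μV Kᶜ = 0) ∧
      (∀ ν : Measure ℝ, IsProbabilityMeasure ν → energyV V μV ≤ energyV V ν) ∧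
      (∀ ν : Measure ℝ, IsProbabilityMeasure ν →
        (∀ μ : Measure ℝ, IsProbabilityMeasure μ → energyV V ν ≤ energyV V μ) → ν = μV) := by
  have hV : Continuous V := continuous_iff_continuousAt.2 fun x => (hanalytic x).continuousAt
  obtain ⟨B, hB0, hB⟩ := exists_linear_lower_bound hV hgrowth.1 hgrowth.2 4
  have hker := kernelV_lower_bound hB
  have hnonneg : ∀ t s, 0 ≤ kernelV V t s + B := fun t s => by
    linarith [hker t s, abs_nonneg t, abs_nonneg s]
  have hVB : ∀ x, 0 ≤ V x + B := fun x => by linarith [hB x, abs_nonneg x]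
  have hle := fun (μ ν : Measure ℝ) (_ : IsProbabilityMeasure μ) (_ : IsProbabilityMeasure ν) =>
    energyV_le_iff hV.measurable hB0 hnonneg μ ν
  set ρ : Measure ℝ := volume.restrict (Icc (0 : ℝ) 1) with hρ
  have hρprob : IsProbabilityMeasure ρ := isProbabilityMeasure_volume_restrict_unit
  have hρtop : shiftedEnergy V B ρ ≠ ⊤ := (shiftedEnergy_unit_lt_top hV B).ne
  set M := (shiftedEnergy V B ρ).toReal with hM
  have hM0 : 0 ≤ M := ENNReal.toReal_nonneg
  have hρM : shiftedEnergy V B ρ = ENNReal.ofReal M := (ENNReal.ofReal_toReal hρtop).symm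
  have hρK : ρ (Icc (-(M + 1)) (M + 1))ᶜ = 0 := by
    rw [hρ, Measure.restrict_apply measurableSet_Icc.compl]
    convert measure_empty (μ := (volume : Measure ℝ))
    refine eq_empty_of_forall_notMem fun x hx => hx.1 ⟨?_, ?_⟩
    · linarith [hx.2.1]
    · linarith [hx.2.2]
  obtain ⟨μ, hμ, hμK, hμmin⟩ := exists_isMinOn_shiftedEnergy hV B isCompact_Icc hρK
  have hμρ := hμmin ρ hρprob hρK
  have hμle : ∀ ν : Measure ℝ, IsProbabilityMeasure ν →
      shiftedEnergy V B μ ≤ shiftedEnergy V B ν := by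
    intro ν hν
    rcases le_total (shiftedEnergy V B ν) (ENNReal.ofReal M) with h | h
    · obtain ⟨ν', hν', hν'K, hle', -⟩ := exists_shiftedEnergy_le_of_compact hker hM0 ν h
      exact (hμmin ν' hν' hν'K).trans hle'
    · exact (hμρ.trans_eq hρM).trans h
  refine ⟨μ, hμ, ⟨_, isCompact_Icc, hμK⟩, fun ν hν => (hle μ ν hμ hν).2 (hμle ν hν), ?_⟩
  intro ν hν hνmin
  have hνle : ∀ σ : Measure ℝ, IsProbabilityMeasure σ →
      shiftedEnergy V B ν ≤ shiftedEnergy V B σ := fun σ hσ => (hle ν σ hν hσ).1 (hνmin σ hσ)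
  have hνK : ν (Icc (-(M + 1)) (M + 1))ᶜ = 0 := by
    obtain ⟨ν', hν', -, -, hsupp⟩ :=
      exists_shiftedEnergy_le_of_compact hker hM0 ν ((hνle ρ hρprob).trans_eq hρM)
    exact hsupp (hνle ν' hν')
  have hD : 0 ≤ 1/2 * Real.log (2 * (M + 1)) + 1/2 * Real.log (Real.exp (M + 1)) := by
    rw [Real.log_exp]
    have := Real.log_nonneg (by linarith : 1 ≤ 2 * (M + 1))
    linarith
  have hshift := fun (σ : Measure ℝ) (_ : IsProbabilityMeasure σ) =>
    shiftedEnergy_add hnonneg hD σ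
  refine (eq_of_isMin_shiftedEnergy hV (by linarith) hVB hμK hνK rfl ?_ ?_ ?_).symm
  · rw [hshift μ hμ]
    exact ENNReal.add_ne_top.2 ⟨ne_top_of_le_ne_top hρtop hμρ, ENNReal.ofReal_ne_top⟩
  · intro σ hσ
    rw [hshift μ hμ, hshift σ hσ]
    gcongr
    exact hμle σ hσ
  · intro σ hσ
    rw [hshift ν hν, hshift σ hσ]
    gcongr
    exact hνle σ hσ
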